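/- Assume 0 < q < 1 and let n ≥ 0 be an integer. For 0 ≤ μ ≤ n set α_{nμ} = ∏_{k=0}^{n−μ−1} (1 − q^{2(n−k)})/(1 − q^{2(k+1)}) and β_{nμ} = q^{2μ}·∏_{k=0}^{μ−1} (1 − q^{−2(n−k)})/(1 − q^{−2(k+1)}) (these are positive real numbers). Define the (n+1)×(n+1) matrices over A with entries (p_n)^{μ}{}_{ν} = √(β_{nμ}β_{nν})·(c*)^{μ}(a*)^{n−μ}a^{n−ν}c^{ν} and (p_{−n})^{μ}{}_{ν} = √(α_{nμ}α_{nν})·c^{n−μ}a^{μ}(a*)^{ν}(c*)^{n−ν}. Then p_n² = p_n and p_{−n}² = p_{−n}. -/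

import Mathlib

open Finset

/-- The Gaussian binomial coefficient `[n choose m]_r`, as a quotient of products. -/
def gaussBinom {K : Type*} [Field K] (r : K) (n m : ℕ) : K :=
  ∏ k ∈ Finset.range m, (1 - r ^ (n - k)) / (1 - r ^ (k + 1))

theorem gaussBinom_zero {K : Type*} [Field K] (r : K) (n : ℕ) : gaussBinom r n 0 = 1 := by
  simp [gaussBinom]

theorem gaussBinom_self_succ {K : Type*} [Field K] (r : K) (n : ℕ) :
    gaussBinom r n (n + 1) = 0 :=
  Finset.prod_eq_zero (Finset.self_mem_range_succ n) (by simp)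

/-- The `q`-Pascal rule. -/
theorem gaussBinom_succ_succ {K : Type*} [Field K] {r : K} (hr : ∀ k : ℕ, r ^ (k + 1) ≠ 1)
    {n m : ℕ} (hm : m ≤ n) :
    gaussBinom r (n + 1) (m + 1) = gaussBinom r n (m + 1) + r ^ (n - m) * gaussBinom r n m := by
  have hne : ∀ k : ℕ, 1 - r ^ (k + 1) ≠ 0 := fun k h => hr k (sub_eq_zero.mp h).symm
  have h1 : gaussBinom r (n + 1) (m + 1)
      = gaussBinom r n m * ((1 - r ^ (n + 1)) / (1 - r ^ (m + 1))) := by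
    simp only [gaussBinom, Finset.prod_div_distrib]
    rw [Finset.prod_range_succ', Finset.prod_range_succ (fun k => 1 - r ^ (k + 1)), mul_div_mul_comm]
    simp
  have h2 : gaussBinom r n (m + 1)
      = gaussBinom r n m * ((1 - r ^ (n - m)) / (1 - r ^ (m + 1))) :=
    Finset.prod_range_succ _ _
  have h3 : r ^ (n + 1) = r ^ (n - m) * r ^ (m + 1) := by
    rw [← pow_add]
    congr 1
    lia
  rw [h1, h2, h3]
  have := hne m
  field_simp
  ring

theorem mul_pow_of_mul_eq_smul_mul {K A : Type*} [Field K] [Ring A] [Algebra K A]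
    {r : K} {x z : A} (hzx : z * x = r • (x * z)) (k : ℕ) :
    z * x ^ k = r ^ k • (x ^ k * z) := by
  induction k with
  | zero => simp
  | succ k ih =>
    rw [pow_succ, ← mul_assoc, ih, smul_mul_assoc, mul_assoc, hzx, mul_smul_comm, smul_smul,
      ← pow_succ, mul_assoc]

/-- A `q`-binomial expansion of the relation `x * y + s • z = 1`. -/
theorem sum_gaussBinom_smul_eq_one {K A : Type*} [Field K] [Ring A] [Algebra K A]
    {r s : K} {x y z : A} (hr : ∀ k : ℕ, r ^ (k + 1) ≠ 1) (hzx : z * x = r • (x * z))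
    (hxy : x * y + s • z = 1) (n : ℕ) :
    ∑ m ∈ Finset.range (n + 1),
      (s ^ m * gaussBinom r n m) • (x ^ (n - m) * z ^ m * y ^ (n - m)) = 1 := by
  induction n with
  | zero => simp [gaussBinom_zero]
  | succ n ih =>
    have hA : x * y = ∑ m ∈ Finset.range (n + 2),
        (s ^ m * gaussBinom r n m) • (x ^ (n + 1 - m) * z ^ m * y ^ (n + 1 - m)) := by
      rw [Finset.sum_range_succ, gaussBinom_self_succ, mul_zero, zero_smul, add_zero]
      calc x * y = x * 1 * y := by rw [mul_one]
        _ = _ := by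
          rw [← ih, Finset.mul_sum, Finset.sum_mul]
          refine Finset.sum_congr rfl fun m hm => ?_
          have hm' : n + 1 - m = n - m + 1 := by
            have := Finset.mem_range.mp hm
            lia
          rw [hm', mul_smul_comm, smul_mul_assoc, pow_succ' x, pow_succ y]
          simp only [mul_assoc]
    have hB : s • z = ∑ m ∈ Finset.range (n + 1),
        (s ^ (m + 1) * (r ^ (n - m) * gaussBinom r n m)) •
          (x ^ (n - m) * z ^ (m + 1) * y ^ (n - m)) := by
      calc s • z = s • (z * 1) := by rw [mul_one]
        _ = _ := by
          rw [← ih, Finset.mul_sum, Finset.smul_sum]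
          refine Finset.sum_congr rfl fun m _ => ?_
          rw [mul_smul_comm, ← mul_assoc, ← mul_assoc, mul_pow_of_mul_eq_smul_mul hzx,
            smul_mul_assoc, smul_mul_assoc, smul_smul, smul_smul, pow_succ' z, mul_assoc (x ^ _) z]
          congr 1
          ring
    rw [← hxy, hA, hB, Finset.sum_range_succ', Finset.sum_range_succ' _ (n + 1), add_right_comm,
      ← Finset.sum_add_distrib, gaussBinom_zero, gaussBinom_zero]
    congr 1
    refine Finset.sum_congr rfl fun m hm => ?_
    rw [gaussBinom_succ_succ hr (Nat.lt_succ_iff.mp (Finset.mem_range.mp hm)),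
      Nat.add_sub_add_right, mul_add, add_smul]

/-- A partition of unity `∑ w j • (v j * u j) = 1` gives an idempotent matrix. -/
theorem Matrix.mul_self_of_sum_smul_mul_eq_one {ι A : Type*} [Fintype ι] [Ring A] [Algebra ℂ A]
    {w : ι → ℝ} (hw : ∀ i, 0 ≤ w i) {u v : ι → A} (huv : ∑ j, (w j : ℂ) • (v j * u j) = 1)
    {M : Matrix ι ι A} (hM : ∀ i j, M i j = ((Real.sqrt (w i * w j) : ℝ) : ℂ) • (u i * v j)) :
    M * M = M := by
  ext i k
  rw [Matrix.mul_apply, hM i k]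
  calc ∑ j, M i j * M j k
      = ∑ j, ((Real.sqrt (w i * w k) : ℝ) : ℂ) • (u i * ((w j : ℂ) • (v j * u j)) * v k) := by
        refine Finset.sum_congr rfl fun j _ => ?_
        have hs : Real.sqrt (w i * w j) * Real.sqrt (w j * w k)
            = Real.sqrt (w i * w k) * w j := by
          rw [Real.sqrt_mul (hw i), Real.sqrt_mul (hw j), Real.sqrt_mul (hw i)]
          linear_combination Real.sqrt (w i) * Real.sqrt (w k) * Real.mul_self_sqrt (hw j)
        rw [hM, hM, smul_mul_assoc, mul_smul_comm, smul_smul, ← Complex.ofReal_mul, hs,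
          mul_smul_comm, smul_mul_assoc, smul_smul, Complex.ofReal_mul]
        simp only [mul_assoc]
    _ = _ := by rw [← Finset.smul_sum, ← Finset.sum_mul, ← Finset.mul_sum, huv, mul_one]

/-- For `0 < q < 1` and `n ≥ 0`, the matrices
`(p_n)^μ_ν = √(β_{nμ}β_{nν})·(c*)^μ(a*)^{n−μ}a^{n−ν}c^ν` and
`(p_{−n})^μ_ν = √(α_{nμ}α_{nν})·c^{n−μ}a^μ(a*)^ν(c*)^{n−ν}` over the quantum 3-sphere
algebra are idempotent: `p_n² = p_n` and `p_{−n}² = p_{−n}`. -/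
theorem qsphere_line_bundle_projections
    {A : Type*} [Ring A] [StarRing A] [Algebra ℂ A]
    (q : ℝ) (hq0 : 0 < q) (hq1 : q < 1)
    (a c : A)
    (hac : a * c = (q : ℂ) • (c * a))
    (hacs : a * star c = (q : ℂ) • (star c * a))
    (hcas : c * star a = (q : ℂ) • (star a * c))
    (hcsas : star c * star a = (q : ℂ) • (star a * star c))
    (hccs : c * star c = star c * c)
    (hunit1 : star a * a + star c * c = 1)
    (hunit2 : a * star a + (q : ℂ) ^ 2 • (c * star c) = 1)
    (n : ℕ)
    (α β : ℕ → ℝ)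
    (hα : ∀ μ, α μ = ∏ k ∈ Finset.range (n - μ),
      (1 - q ^ (2 * (n - k))) / (1 - q ^ (2 * (k + 1))))
    (hβ : ∀ μ, β μ = q ^ (2 * μ) * ∏ k ∈ Finset.range μ,
      (1 - (q ^ (2 * (n - k)))⁻¹) / (1 - (q ^ (2 * (k + 1)))⁻¹))
    (P Q : Matrix (Fin (n + 1)) (Fin (n + 1)) A)
    (hP : ∀ μ ν : Fin (n + 1),
      P μ ν = ((Real.sqrt (β μ * β ν) : ℝ) : ℂ)
        • ((star c) ^ (μ : ℕ) * (star a) ^ (n - (μ : ℕ))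
            * a ^ (n - (ν : ℕ)) * c ^ (ν : ℕ)))
    (hQ : ∀ μ ν : Fin (n + 1),
      Q μ ν = ((Real.sqrt (α μ * α ν) : ℝ) : ℂ)
        • (c ^ (n - (μ : ℕ)) * a ^ (μ : ℕ)
            * (star a) ^ (ν : ℕ) * (star c) ^ (n - (ν : ℕ)))) :
    P * P = P ∧ Q * Q = Q := by
  have hzs : (c * star c) * star a = ((q : ℂ) ^ 2) • (star a * (c * star c)) := by
    rw [mul_assoc, hcsas, mul_smul_comm, ← mul_assoc, hcas, smul_mul_assoc, smul_smul, ← sq,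
      mul_assoc]
  have haz : a * (c * star c) = ((q : ℂ) ^ 2) • ((c * star c) * a) := by
    rw [← mul_assoc, hac, smul_mul_assoc, mul_assoc, hacs, mul_smul_comm, smul_smul, ← sq,
      ← mul_assoc]
  have hqC : (q : ℂ) ^ 2 ≠ 0 := pow_ne_zero 2 (Complex.ofReal_ne_zero.mpr hq0.ne')
  have hza : (c * star c) * a = (((q : ℂ) ^ 2)⁻¹) • (a * (c * star c)) := by
    rw [haz, smul_smul, inv_mul_cancel₀ hqC, one_smul]
  have hlt : ∀ k : ℕ, q ^ (2 * (k + 1)) < 1 := fun k =>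
    pow_lt_one₀ hq0.le hq1 (by lia)
  have hle : ∀ k : ℕ, q ^ (2 * k) ≤ 1 := fun k => pow_le_one₀ hq0.le hq1.le
  have hr : ∀ k : ℕ, ((q : ℂ) ^ 2) ^ (k + 1) ≠ 1 := fun k h => by
    rw [← pow_mul] at h
    exact (hlt k).ne (by exact_mod_cast h)
  have hr' : ∀ k : ℕ, (((q : ℂ) ^ 2)⁻¹) ^ (k + 1) ≠ 1 := fun k h => by
    rw [inv_pow, inv_eq_one] at h
    exact hr k h
  have hα' : ∀ μ, (α μ : ℂ) = gaussBinom ((q : ℂ) ^ 2) n (n - μ) := fun μ => by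
    rw [hα, gaussBinom]
    push_cast
    simp only [pow_mul]
  have hβ' : ∀ μ, (β μ : ℂ) = ((q : ℂ) ^ 2) ^ μ * gaussBinom (((q : ℂ) ^ 2)⁻¹) n μ := fun μ => by
    rw [hβ, gaussBinom]
    push_cast
    simp only [pow_mul, inv_pow]
  have hα0 : ∀ μ, 0 ≤ α μ := fun μ => by
    rw [hα]
    exact Finset.prod_nonneg fun k _ =>
      div_nonneg (sub_nonneg.mpr (hle _)) (sub_nonneg.mpr (hle _))
  have hβ0 : ∀ μ, 0 ≤ β μ := fun μ => by
    rw [hβ]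
    exact mul_nonneg (pow_nonneg hq0.le _) <| Finset.prod_nonneg fun k _ =>
      div_nonneg_of_nonpos
        (sub_nonpos.mpr ((one_le_inv₀ (pow_pos hq0 _)).mpr (hle _)))
        (sub_nonpos.mpr ((one_le_inv₀ (pow_pos hq0 _)).mpr (hle _)))
  have hcomm : Commute c (star c) := hccs
  constructor
  · refine Matrix.mul_self_of_sum_smul_mul_eq_one (ι := Fin (n + 1)) (w := fun i => β i)
      (fun i => hβ0 i)
      (u := fun i => star c ^ (i : ℕ) * star a ^ (n - (i : ℕ)))
      (v := fun i => a ^ (n - (i : ℕ)) * c ^ (i : ℕ)) ?_ fun i j => ?_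
    · rw [Fin.sum_univ_eq_sum_range
        (fun i => (β i : ℂ) • (a ^ (n - i) * c ^ i * (star c ^ i * star a ^ (n - i)))) (n + 1),
        ← sum_gaussBinom_smul_eq_one hr' hza hunit2 n]
      refine Finset.sum_congr rfl fun m _ => ?_
      rw [hβ', hcomm.mul_pow]
      simp only [mul_assoc]
    · rw [hP]
      simp only [mul_assoc]
  · refine Matrix.mul_self_of_sum_smul_mul_eq_one (ι := Fin (n + 1)) (w := fun i => α i)
      (fun i => hα0 i)
      (u := fun i => c ^ (n - (i : ℕ)) * a ^ (i : ℕ))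
      (v := fun i => star a ^ (i : ℕ) * star c ^ (n - (i : ℕ))) ?_ fun i j => ?_
    · have hunit : star a * a + (1 : ℂ) • (c * star c) = 1 := by rw [one_smul, hccs, hunit1]
      rw [Fin.sum_univ_eq_sum_range
        (fun i => (α i : ℂ) • (star a ^ i * star c ^ (n - i) * (c ^ (n - i) * a ^ i))) (n + 1),
        ← sum_gaussBinom_smul_eq_one hr hzs hunit n, ← Finset.sum_range_reflect]
      refine Finset.sum_congr rfl fun m hm => ?_
      have hm' : n + 1 - 1 - m = n - m := by lia
      have hm'' : n - (n - m) = m := Nat.sub_sub_self (Nat.lt_succ_iff.mp (Finset.mem_range.mp hm))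
      rw [hm', hα', hm'', hccs, hcomm.symm.mul_pow, one_pow, one_mul]
      simp only [mul_assoc]
    · rw [hQ]
      simp only [mul_assoc]
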